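/- Let v solve the Goursat integral equation v = v₀ + Vv. Then for each fixed η, v(·,η) is absolutely continuous in ξ and v_ξ(ξ,η) = (1/4) q(ξ/2) − (1/4)∫_ξ^η q((η₁−ξ)/2) v(ξ,η₁) dη₁ + (1/4)∫₀^ξ q((ξ−ξ₁)/2) v(ξ₁,ξ) dξ₁ for a.e. ξ ∈ [0,η]. -/

import Mathlib

open MeasureTheory Set

abbrev MatC (n : ℕ) := EuclideanSpace ℂ (Fin n) →L[ℂ] EuclideanSpace ℂ (Fin n)

noncomputable def v0fun (n : ℕ) (q : ℝ → MatC n) (ξ η : ℝ) : MatC n :=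
  -((1 / 2 : ℂ) • ∫ s in (ξ / 2)..(η / 2), q s)

noncomputable def Vop (n : ℕ) (q : ℝ → MatC n) (v : ℝ → ℝ → MatC n) :
    ℝ → ℝ → MatC n :=
  fun ξ η => -((1 / 4 : ℂ) • ∫ ξ₁ in (0:ℝ)..ξ, ∫ η₁ in ξ..η, q ((η₁ - ξ₁) / 2) * v ξ₁ η₁)

/-- The claimed a.e. `ξ`-derivative of `v(·,η)`. -/
noncomputable def vXi (n : ℕ) (q : ℝ → MatC n) (v : ℝ → ℝ → MatC n) (η ξ : ℝ) : MatC n :=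
  (1 / 4 : ℂ) • q (ξ / 2)
    - (1 / 4 : ℂ) • (∫ η₁ in ξ..η, q ((η₁ - ξ) / 2) * v ξ η₁)
    + (1 / 4 : ℂ) • (∫ ξ₁ in (0:ℝ)..ξ, q ((ξ - ξ₁) / 2) * v ξ₁ ξ)

/-- The Goursat integrand `q((b - a)/2) v(a, b)`, extended by zero off `0 < a < b ≤ η`. -/
noncomputable def goursatKernel {n : ℕ} (q : ℝ → MatC n) (v : ℝ → ℝ → MatC n) (η : ℝ) :
    ℝ × ℝ → MatC n :=
  {p : ℝ × ℝ | 0 < p.1 ∧ p.1 < p.2 ∧ p.2 ≤ η}.indicator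
    fun p => q ((p.2 - p.1) / 2) * v p.1 p.2

theorem goursatKernel_of_mem {n : ℕ} (q : ℝ → MatC n) (v : ℝ → ℝ → MatC n) {η a b : ℝ}
    (h : 0 < a ∧ a < b ∧ b ≤ η) : goursatKernel q v η (a, b) = q ((b - a) / 2) * v a b :=
  indicator_of_mem (s := {p : ℝ × ℝ | 0 < p.1 ∧ p.1 < p.2 ∧ p.2 ≤ η}) h _

theorem goursatKernel_of_not_mem {n : ℕ} (q : ℝ → MatC n) (v : ℝ → ℝ → MatC n) {η a b : ℝ}
    (h : ¬(0 < a ∧ a < b ∧ b ≤ η)) : goursatKernel q v η (a, b) = 0 :=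
  indicator_of_notMem (s := {p : ℝ × ℝ | 0 < p.1 ∧ p.1 < p.2 ∧ p.2 ≤ η}) h _

/-- For an integrable kernel supported in `0 < a < b ≤ η`, the rectangle integral over
`(0, ξ] × (ξ, η]` is the difference of the integrals over the vertical and horizontal strips. -/
theorem integral_rectangle_eq_sub_of_triangle_support {E : Type*} [NormedAddCommGroup E]
    [NormedSpace ℝ E] {K : ℝ × ℝ → E} (hK : Integrable K) {ξ η : ℝ}
    (hsupp : ∀ a b, ¬(0 < a ∧ a < b ∧ b ≤ η) → K (a, b) = 0) :
    ∫ a in Ioc 0 ξ, ∫ b in Ioc ξ η, K (a, b) =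
      (∫ a in Ioc 0 ξ, ∫ b, K (a, b)) - ∫ b in Ioc 0 ξ, ∫ a, K (a, b) := by
  have hvert : ∫ a in Ioc 0 ξ, ∫ b, K (a, b) =
      ∫ p in Ioc 0 ξ ×ˢ (Ioc 0 ξ ∪ Ioc ξ η), K p := by
    rw [← setIntegral_eq_of_subset_of_forall_sdiff_eq_zero
      (measurableSet_Ioc.prod MeasurableSet.univ) (prod_mono_right (subset_univ _)),
      Measure.volume_eq_prod, setIntegral_prod _ hK.integrableOn]
    · simp
    · rintro ⟨a, b⟩ h
      apply hsupp
      simp only [mem_sdiff, mem_prod, mem_Ioc, mem_univ, mem_union] at h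
      grind
  have hhor : ∫ b in Ioc 0 ξ, ∫ a, K (a, b) = ∫ p in Ioc 0 ξ ×ˢ Ioc 0 ξ, K p := by
    rw [← setIntegral_eq_of_subset_of_forall_sdiff_eq_zero
      (MeasurableSet.univ.prod measurableSet_Ioc) (prod_mono_left (subset_univ _)),
      Measure.volume_eq_prod, ← setIntegral_prod_swap,
      setIntegral_prod (fun p => K p.swap) hK.swap.integrableOn]
    · simp
    · rintro ⟨a, b⟩ h
      apply hsupp
      simp only [mem_sdiff, mem_prod, mem_Ioc, mem_univ] at h
      grind
  have hdisj : Disjoint (Ioc 0 ξ ×ˢ Ioc 0 ξ) (Ioc 0 ξ ×ˢ Ioc ξ η) :=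
    Disjoint.set_prod_right (Ioc_disjoint_Ioc_of_le le_rfl) _ _
  rw [hvert, hhor, prod_union, setIntegral_union hdisj (measurableSet_Ioc.prod measurableSet_Ioc)
    hK.integrableOn hK.integrableOn, add_sub_cancel_left, Measure.volume_eq_prod,
    setIntegral_prod _ hK.integrableOn]

theorem integrable_and_integral_smul_sub_add {α E : Type*} [MeasurableSpace α] {μ : Measure α}
    [NormedAddCommGroup E] [NormedSpace ℂ E] {f g h : α → E} (hf : Integrable f μ)
    (hg : Integrable g μ) (hh : Integrable h μ) (c : ℂ) :
    Integrable (fun x => c • f x - c • g x + c • h x) μ ∧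
      ∫ x, (c • f x - c • g x + c • h x) ∂μ =
        c • (∫ x, f x ∂μ) - c • (∫ x, g x ∂μ) + c • ∫ x, h x ∂μ := by
  have hf' : Integrable (fun x => c • f x) μ := hf.smul c
  have hg' : Integrable (fun x => c • g x) μ := hg.smul c
  have hh' : Integrable (fun x => c • h x) μ := hh.smul c
  have hfg : Integrable (fun x => c • f x - c • g x) μ := hf'.sub hg'
  refine ⟨hfg.add hh', ?_⟩
  rw [integral_add hfg hh', integral_sub hf' hg', integral_smul, integral_smul,
    integral_smul]

theorem integrable_indicator_comp_div_two {E : Type*} [NormedAddCommGroup E] {q : ℝ → E} {c : ℝ}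
    (hq : IntegrableOn q (Icc 0 c)) : Integrable fun x : ℝ => (Icc 0 c).indicator q (x / 2) :=
  ((integrable_indicator_iff measurableSet_Icc).2 hq).comp_div two_ne_zero

theorem integrable_goursatKernel {n : ℕ} {q : ℝ → MatC n} {v : ℝ → ℝ → MatC n} {η : ℝ}
    (hq : IntegrableOn q (Icc 0 (η / 2)))
    (hv : ContinuousOn (fun p : ℝ × ℝ => v p.1 p.2)
      {p : ℝ × ℝ | 0 ≤ p.1 ∧ p.1 ≤ p.2 ∧ p.2 ≤ η}) :
    Integrable (goursatKernel q v η) := by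
  set Δ : Set (ℝ × ℝ) := {p | 0 < p.1 ∧ p.1 < p.2 ∧ p.2 ≤ η} with hΔ
  set D : Set (ℝ × ℝ) := {p | 0 ≤ p.1 ∧ p.1 ≤ p.2 ∧ p.2 ≤ η} with hD
  have hΔD : Δ ⊆ D := fun p hp => ⟨hp.1.le, hp.2.1.le, hp.2.2⟩
  have hΔm : MeasurableSet Δ := by
    simp only [hΔ]
    measurability
  have hDclosed : IsClosed D :=
    (isClosed_le continuous_const continuous_fst).inter
      ((isClosed_le continuous_fst continuous_snd).inter
        (isClosed_le continuous_snd continuous_const))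
  have hDcompact : IsCompact D := by
    refine (isCompact_Icc (a := ((0 : ℝ), (0 : ℝ))) (b := (η, η))).of_isClosed_subset hDclosed ?_
    rintro ⟨a, b⟩ ⟨h1, h2, h3⟩
    exact ⟨⟨h1, h1.trans h2⟩, ⟨h2.trans h3, h3⟩⟩
  obtain ⟨C, hC⟩ := hDcompact.exists_bound_of_continuousOn hv
  have hwm : AEStronglyMeasurable (Δ.indicator fun p : ℝ × ℝ => v p.1 p.2) :=
    (aestronglyMeasurable_indicator_iff hΔm).2
      ((hv.aestronglyMeasurable_of_isCompact hDcompact hDclosed.measurableSet).mono_set hΔD)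
  have hwb : ∀ p, ‖Δ.indicator (fun p : ℝ × ℝ => v p.1 p.2) p‖ ≤ max C 0 := by
    intro p
    by_cases hp : p ∈ Δ
    · simpa [hp] using Or.inl (hC p (hΔD hp))
    · simp [hp]
  have hf : Integrable ((Icc 0 η).indicator fun _ : ℝ => (1 : ℝ)) :=
    (integrable_indicator_iff measurableSet_Icc).2 (by simp)
  have hg : Integrable fun x : ℝ => (Icc 0 (η / 2)).indicator q (x / 2) :=
    integrable_indicator_comp_div_two hq
  have hconv := (hf.convolution_integrand (ContinuousLinearMap.lsmul ℝ ℝ) hg).swap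
  refine (hconv.mul_bdd hwm (Filter.Eventually.of_forall hwb)).congr
    (Filter.Eventually.of_forall ?_)
  rintro ⟨a, b⟩
  by_cases hp : (a, b) ∈ Δ
  · have hp' : 0 < a ∧ a < b ∧ b ≤ η := hp
    have h1 : a ∈ Icc 0 η := ⟨by linarith, by linarith⟩
    have h2 : (b - a) / 2 ∈ Icc 0 (η / 2) := ⟨by linarith, by linarith⟩
    simp [goursatKernel, ← hΔ, hp, h1, h2]
  · simp [goursatKernel, ← hΔ, hp]

theorem intervalIntegral_eq_integral_goursatKernel_right {n : ℕ} (q : ℝ → MatC n)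
    (v : ℝ → ℝ → MatC n) {ξ η : ℝ} (h0 : 0 < ξ) (hξη : ξ ≤ η) :
    ∫ b in ξ..η, q ((b - ξ) / 2) * v ξ b = ∫ b, goursatKernel q v η (ξ, b) := by
  rw [intervalIntegral.integral_of_le hξη, ← integral_indicator measurableSet_Ioc]
  congr 1
  funext b
  simp only [goursatKernel, indicator_apply, mem_Ioc, mem_ofPred_eq, h0, true_and]

theorem intervalIntegral_eq_integral_goursatKernel_left {n : ℕ} (q : ℝ → MatC n)
    (v : ℝ → ℝ → MatC n) {ξ η : ℝ} (h0 : 0 < ξ) (hξη : ξ ≤ η) :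
    ∫ a in (0 : ℝ)..ξ, q ((ξ - a) / 2) * v a ξ = ∫ a, goursatKernel q v η (a, ξ) := by
  rw [intervalIntegral.integral_of_le h0.le, integral_Ioc_eq_integral_Ioo,
    ← integral_indicator measurableSet_Ioo]
  congr 1
  funext a
  simp only [goursatKernel, indicator_apply, mem_Ioo, mem_ofPred_eq, hξη, and_true]

theorem Vop_eq_integral_goursatKernel {n : ℕ} (q : ℝ → MatC n) (v : ℝ → ℝ → MatC n) {ξ η : ℝ}
    (h0 : 0 ≤ ξ) (hξη : ξ ≤ η) :
    Vop n q v ξ η =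
      -((1 / 4 : ℂ) • ∫ a in Ioc 0 ξ, ∫ b in Ioc ξ η, goursatKernel q v η (a, b)) := by
  simp only [Vop, intervalIntegral.integral_of_le h0, intervalIntegral.integral_of_le hξη]
  congr 2
  refine setIntegral_congr_fun measurableSet_Ioc fun a ha => ?_
  refine setIntegral_congr_fun measurableSet_Ioc fun b hb => ?_
  exact (goursatKernel_of_mem q v ⟨ha.1, ha.2.trans_lt hb.1, hb.2⟩).symm

theorem Vop_zero_left {n : ℕ} (q : ℝ → MatC n) (v : ℝ → ℝ → MatC n) (η : ℝ) :
    Vop n q v 0 η = 0 := by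
  rw [Vop, intervalIntegral.integral_same]
  ext x
  change (-((1 / 4 : ℂ) • (0 : EuclideanSpace ℂ (Fin n)))).ofLp _ = _
  simp

theorem v0fun_eq_add_integral {n : ℕ} {q : ℝ → MatC n} {ξ η : ℝ}
    (hq : IntegrableOn q (Icc 0 (η / 2))) (h0 : 0 ≤ ξ) (hξη : ξ ≤ η) :
    v0fun n q ξ η = v0fun n q 0 η + (1 / 4 : ℂ) • ∫ s in (0 : ℝ)..ξ, q (s / 2) := by
  have hint : ∀ x ∈ Icc 0 (η / 2), ∀ y ∈ Icc 0 (η / 2), IntervalIntegrable q volume x y :=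
    fun x hx y hy => (hq.mono_set (uIcc_subset_Icc hx hy)).intervalIntegrable
  have hξ : ξ / 2 ∈ Icc 0 (η / 2) := ⟨by linarith, by linarith⟩
  have hz : (0 : ℝ) ∈ Icc 0 (η / 2) := ⟨le_rfl, by linarith⟩
  have hη : η / 2 ∈ Icc 0 (η / 2) := ⟨by linarith, le_rfl⟩
  rw [intervalIntegral.integral_comp_div q two_ne_zero, v0fun, v0fun, zero_div,
    ← intervalIntegral.integral_add_adjacent_intervals (hint _ hz _ hξ) (hint _ hξ _ hη),
    ← Complex.coe_smul, smul_smul, smul_add]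
  norm_num

/-- For the continuous solution `v` of the Goursat integral equation
`v = v₀ + Vv`, for each fixed `η` the map `ξ ↦ v(ξ,η)` is absolutely continuous
(it is the indefinite integral of an integrable function) and
`v_ξ(ξ,η) = (1/4)q(ξ/2) − (1/4)∫_ξ^η q((η₁−ξ)/2) v(ξ,η₁) dη₁
 + (1/4)∫₀^ξ q((ξ−ξ₁)/2) v(ξ₁,ξ) dξ₁` for a.e. `ξ ∈ [0,η]`. -/
theorem stmt8 (n : ℕ) (q : ℝ → MatC n)
    (hq : LocallyIntegrableOn q (Ici (0 : ℝ))) (T : ℝ) (hT : 0 < T)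
    (v : ℝ → ℝ → MatC n)
    (hcont : ContinuousOn (fun p : ℝ × ℝ => v p.1 p.2)
        {p : ℝ × ℝ | 0 ≤ p.1 ∧ p.1 ≤ p.2 ∧ p.2 ≤ T})
    (heq : ∀ ξ η : ℝ, 0 ≤ ξ → ξ ≤ η → η ≤ T →
        v ξ η = v0fun n q ξ η + Vop n q v ξ η) :
    ∀ η ∈ Icc (0:ℝ) T,
      IntegrableOn (vXi n q v η) (Icc 0 η) ∧
      (∀ ξ ∈ Icc (0:ℝ) η, v ξ η = v 0 η + ∫ s in (0:ℝ)..ξ, vXi n q v η s) ∧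
      (∀ᵐ ξ ∂(volume.restrict (Icc (0:ℝ) η)),
        HasDerivWithinAt (fun ξ' => v ξ' η) (vXi n q v η ξ) (Icc (0:ℝ) η) ξ) := by
  intro η hη
  have hqη : IntegrableOn q (Icc 0 (η / 2)) :=
    hq.integrableOn_compact_subset Icc_subset_Ici_self isCompact_Icc
  have hK : Integrable (goursatKernel q v η) :=
    integrable_goursatKernel hqη (hcont.mono fun p hp => ⟨hp.1, hp.2.1, hp.2.2.trans hη.2⟩)
  have hq2 : IntegrableOn (fun s => q (s / 2)) (Ioc 0 η) := by
    refine (integrable_indicator_comp_div_two hqη).integrableOn.congr_fun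
      (fun s hs => indicator_of_mem ?_ _) measurableSet_Ioc
    exact ⟨by linarith [hs.1], by linarith [hs.2]⟩
  have hright : Integrable fun a => ∫ b, goursatKernel q v η (a, b) := hK.integral_prod_left
  have hleft : Integrable fun b => ∫ a, goursatKernel q v η (a, b) := hK.integral_prod_right
  have hvXi : EqOn (vXi n q v η) (fun s => (1 / 4 : ℂ) • q (s / 2)
      - (1 / 4 : ℂ) • (∫ b, goursatKernel q v η (s, b))
      + (1 / 4 : ℂ) • ∫ a, goursatKernel q v η (a, s)) (Ioc 0 η) := by
    intro s hs
    simp only [vXi, intervalIntegral_eq_integral_goursatKernel_right q v hs.1 hs.2,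
      intervalIntegral_eq_integral_goursatKernel_left q v hs.1 hs.2]
  have hI : IntervalIntegrable (vXi n q v η) volume 0 η := by
    rw [intervalIntegrable_iff_integrableOn_Ioc_of_le hη.1]
    exact IntegrableOn.congr_fun (integrable_and_integral_smul_sub_add hq2 hright.integrableOn
      hleft.integrableOn (1 / 4)).1 hvXi.symm measurableSet_Ioc
  have hftc : ∀ ξ ∈ Icc (0:ℝ) η, v ξ η = v 0 η + ∫ s in (0:ℝ)..ξ, vXi n q v η s := by
    intro ξ hξ
    have hsub : Ioc 0 ξ ⊆ Ioc 0 η := Ioc_subset_Ioc_right hξ.2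
    have hv0 : v 0 η = v0fun n q 0 η := by
      rw [heq 0 η le_rfl hη.1 hη.2, Vop_zero_left, add_zero]
    rw [heq ξ η hξ.1 hξ.2 hη.2, hv0, v0fun_eq_add_integral hqη hξ.1 hξ.2,
      Vop_eq_integral_goursatKernel q v hξ.1 hξ.2,
      integral_rectangle_eq_sub_of_triangle_support hK
        fun _ _ h => goursatKernel_of_not_mem q v h,
      intervalIntegral.integral_of_le hξ.1, intervalIntegral.integral_of_le hξ.1,
      setIntegral_congr_fun measurableSet_Ioc (hvXi.mono hsub),
      (integrable_and_integral_smul_sub_add (hq2.mono_set hsub) hright.integrableOn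
        hleft.integrableOn (1 / 4)).2, smul_sub]
    abel
  refine ⟨(intervalIntegrable_iff_integrableOn_Icc_of_le hη.1).1 hI, hftc, ?_⟩
  rw [ae_restrict_iff' measurableSet_Icc]
  filter_upwards [hI.ae_hasDerivAt_integral] with ξ hd hξ
  rw [uIcc_of_le hη.1] at hd
  exact ((hd hξ 0 ⟨le_rfl, hη.1⟩).const_add (v 0 η)).hasDerivWithinAt.congr hftc (hftc ξ hξ)
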